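/- Let 𝒦 = (K,𝒜) be a system of isometries with associated ℝ-tree T_𝒦, and let w, w′ ∈ F(𝒜) be reduced words with maximal common prefix u ∈ F(𝒜). Then for any triplet of points Q ∈ K, R ∈ wK and R′ ∈ w′K, the intersection of the segments [Q,R] and [Q,R′] in T_𝒦 is a segment [Q,P] whose endpoint P lies in uK. -/

import Mathlib

/-!
Common formalization framework for "ℝ-trees, dual laminations, and compact systems
of partial isometries" (Coulbois–Hilion–Lustig).
-/

open Set Filter Topology Pointwise

noncomputable section

namespace CHL

/-! ### ℝ-trees -/

/-- The metric betweenness segment `[x,y]`.  In an ℝ-tree this is exactly the unique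
topological arc joining `x` to `y`, which is a geodesic segment. -/
def seg {T : Type*} [MetricSpace T] (x y : T) : Set T :=
  {z | dist x z + dist z y = dist x y}

/-- An ℝ-tree: a geodesic metric space which is `0`-hyperbolic (four point condition).
Equivalently, any two points are joined by a unique topological arc, and this arc is a
geodesic segment. -/
class IsRTree (T : Type*) [MetricSpace T] : Prop where
  geodesic : ∀ x y : T, ∃ f : ℝ → T, f 0 = x ∧ f (dist x y) = y ∧
      ∀ s ∈ Set.Icc (0 : ℝ) (dist x y), ∀ t ∈ Set.Icc (0 : ℝ) (dist x y),
        dist (f s) (f t) = |s - t|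
  four_point : ∀ x y z w : T,
      dist x y + dist z w ≤ max (dist x z + dist y w) (dist x w + dist y z)

/-- A subtree of an ℝ-tree: a convex subset. -/
def IsSubtree {T : Type*} [MetricSpace T] (A : Set T) : Prop :=
  ∀ x ∈ A, ∀ y ∈ A, seg x y ⊆ A

/-- A non-empty closed subtree. -/
def IsClosedSubtree {T : Type*} [MetricSpace T] (A : Set T) : Prop :=
  A.Nonempty ∧ IsClosed A ∧ IsSubtree A

/-- The convex hull of a subset of an ℝ-tree: the smallest subtree containing it. -/
def subtreeHull {T : Type*} [MetricSpace T] (S : Set T) : Set T :=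
  ⋂₀ {A : Set T | S ⊆ A ∧ IsSubtree A}

/-- A finite tree: the convex hull of finitely many points. -/
def IsFiniteSubtree {T : Type*} [MetricSpace T] (A : Set T) : Prop :=
  ∃ F : Finset T, A = subtreeHull (F : Set T)

/-- `[x,x']` is the segment joining `A` to `B`: its endpoints are the only points
in `A` resp. `B` that it meets. -/
def IsBridge {T : Type*} [MetricSpace T] (A B : Set T) (x x' : T) : Prop :=
  x ∈ A ∧ x' ∈ B ∧ seg x x' ∩ A = {x} ∧ seg x x' ∩ B = {x'}

/-- A morphism of ℝ-trees: a continuous map such that every segment is mapped locally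
injectively except at finitely many points. -/
def IsTreeMorphism {T T' : Type*} [MetricSpace T] [MetricSpace T'] (f : T → T') : Prop :=
  Continuous f ∧ ∀ x y : T, ∃ F : Finset T, ∀ p ∈ seg x y, p ∉ (F : Set T) →
    ∃ U ∈ nhdsWithin p (seg x y), Set.InjOn f U

/-- The translation length `‖g‖_T = inf_{x ∈ T} d(x, gx)`. -/
def translationLength (G : Type*) [Group G] (T : Type*) [MetricSpace T] [MulAction G T]
    (g : G) : ℝ :=
  ⨅ x : T, dist x (g • x)

/-- The translation length of `g` on an invariant subtree `A`. -/
def translationLengthOn {G : Type*} [Group G] {T : Type*} [MetricSpace T] [MulAction G T]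
    (A : Set T) (g : G) : ℝ :=
  ⨅ x : A, dist (x : T) (g • (x : T))

/-- The minimal `G`-invariant subtree. -/
def minSubtree (G : Type*) [Group G] (T : Type*) [MetricSpace T] [MulAction G T] : Set T :=
  ⋂₀ {A : Set T | A.Nonempty ∧ IsSubtree A ∧ ∀ g : G, ∀ x ∈ A, g • x ∈ A}

/-! ### Free groups, reduced words and the boundary `∂F(𝒜)` -/

/-- Two letters of `𝒜^{±1}` are inverse to each other. -/
def LettersInv {ι : Type*} (a b : ι × Bool) : Prop := a.1 = b.1 ∧ a.2 = !b.2

/-- The prefix of length `n` of (the reduced word of) `w`. -/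
def gprefix {ι : Type*} [DecidableEq ι] (w : FreeGroup ι) (n : ℕ) : FreeGroup ι :=
  FreeGroup.mk (w.toWord.take n)

/-- An infinite reduced word in the letters `𝒜^{±1}`: a point of the Gromov boundary
`∂F(𝒜)` of the free group `F(𝒜)`. -/
structure InfWord (ι : Type*) where
  letter : ℕ → ι × Bool
  reduced : ∀ n, ¬ LettersInv (letter n) (letter (n + 1))

/-- The prefix `X_n` of length `n` of an infinite reduced word `X`. -/
def InfWord.prefixN {ι : Type*} (X : InfWord ι) (n : ℕ) : FreeGroup ι :=
  FreeGroup.mk (List.ofFn fun i : Fin n => X.letter i)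

/-- The infinite word `X_k⁻¹ X` obtained by deleting the first `k` letters. -/
def InfWord.shift {ι : Type*} (X : InfWord ι) (k : ℕ) : InfWord ι :=
  ⟨fun n => X.letter (k + n), fun n => X.reduced (k + n)⟩

/-- A sequence `wₙ ∈ F(𝒜)` converges in `F(𝒜) ∪ ∂F(𝒜)` to the infinite word `X` iff
the length of the maximal common prefix of `wₙ` and `X` tends to infinity. -/
def TendstoBoundary {ι : Type*} [DecidableEq ι] (w : ℕ → FreeGroup ι) (X : InfWord ι) : Prop :=
  ∀ k : ℕ, ∀ᶠ n in atTop, (w n).toWord.take k = List.ofFn fun i : Fin k => X.letter i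

/-- `Y = w · X` for the left action of `F(𝒜)` on its boundary `∂F(𝒜)`. -/
def SmulBoundary {ι : Type*} [DecidableEq ι] (w : FreeGroup ι) (X Y : InfWord ι) : Prop :=
  TendstoBoundary (fun n => w * X.prefixN n) Y

/-- The (Cantor set) topology on `∂F(𝒜)`, induced by the product topology on sequences
of letters. -/
instance {ι : Type*} : TopologicalSpace (InfWord ι) :=
  TopologicalSpace.induced (fun X => X.letter)
    (@Pi.topologicalSpace ℕ (fun _ => ι × Bool) fun _ => ⊥)

/-- A non-trivial element of `F(𝒜)` is cyclically reduced if the first letter of its reduced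
word is not the inverse of its last letter. -/
def IsCyclicallyReduced {ι : Type*} [DecidableEq ι] (w : FreeGroup ι) : Prop :=
  w ≠ 1 ∧ ∀ a ∈ w.toWord.head?, ∀ b ∈ w.toWord.getLast?, ¬ LettersInv a b

/-- The dual laminary language `ℒ_𝒜(T)` of an isometric action of `F(𝒜)` on `T`. -/
def dualLanguage (ι : Type*) [DecidableEq ι] (T : Type*) [MetricSpace T]
    [MulAction (FreeGroup ι) T] : Set (FreeGroup ι) :=
  {v | ∀ ε > (0 : ℝ), ∃ u w : FreeGroup ι,
      (u * v * w).toWord = u.toWord ++ v.toWord ++ w.toWord ∧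
      IsCyclicallyReduced (u * v * w) ∧
      translationLength (FreeGroup ι) T (u * v * w) < ε}

/-- The dual laminary language `ℒ_𝒜(T)`, for the action restricted to an invariant
subtree `A`. -/
def dualLanguageOn (ι : Type*) [DecidableEq ι] {T : Type*} [MetricSpace T]
    [MulAction (FreeGroup ι) T] (A : Set T) : Set (FreeGroup ι) :=
  {v | ∀ ε > (0 : ℝ), ∃ u w : FreeGroup ι,
      (u * v * w).toWord = u.toWord ++ v.toWord ++ w.toWord ∧
      IsCyclicallyReduced (u * v * w) ∧
      translationLengthOn A (u * v * w) < ε}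

/-! ### Systems of isometries on a compact ℝ-tree -/

/-- A system of isometries `𝒦 = (K, 𝒜)`: a family, indexed by `ι`, of non-empty partial
isometries of the compact ℝ-tree `K`, i.e. isometries between non-empty closed subtrees. -/
structure SystemOfIsometries (K : Type*) [MetricSpace K] (ι : Type*) where
  pe : ι → PartialEquiv K K
  isom : ∀ i, ∀ x ∈ (pe i).source, ∀ y ∈ (pe i).source, dist (pe i x) (pe i y) = dist x y
  source_subtree : ∀ i, IsClosedSubtree (pe i).source
  target_subtree : ∀ i, IsClosedSubtree (pe i).target

namespace SystemOfIsometries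

variable {K : Type*} [MetricSpace K] {ι : Type*} (S : SystemOfIsometries K ι)

/-- The partial isometry associated to a letter in `𝒜^{±1}`. -/
def letterPE : ι × Bool → PartialEquiv K K
  | (i, true) => S.pe i
  | (i, false) => (S.pe i).symm

/-- The partial isometry `z₁ ∘ z₂ ∘ ⋯ ∘ zₙ` (acting on the right: first `z₁`, then `z₂`, …)
associated to the reduced word `w = z₁ ⋯ zₙ ∈ F(𝒜)`. -/
def wordPE [DecidableEq ι] (w : FreeGroup ι) : PartialEquiv K K :=
  (w.toWord.map S.letterPE).foldl PartialEquiv.trans (PartialEquiv.refl K)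

/-- The domain `dom (w)` of the partial isometry associated to `w`. -/
def dom [DecidableEq ι] (w : FreeGroup ι) : Set K := (S.wordPE w).source

/-- A word is admissible if it is non-empty as a partial isometry of `K`. -/
def Admissible [DecidableEq ι] (w : FreeGroup ι) : Prop := (S.dom w).Nonempty

/-- An infinite word is admissible if all its prefixes are admissible. -/
def AdmissibleInf [DecidableEq ι] (X : InfWord ι) : Prop := ∀ n, S.Admissible (X.prefixN n)

/-- The domain of an infinite word: the intersection of the domains of its prefixes. -/
def domInf [DecidableEq ι] (X : InfWord ι) : Set K := ⋂ n, S.dom (X.prefixN n)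

/-- An infinite word `X` is eventually admissible if some suffix `X_k⁻¹ X` is admissible. -/
def EventuallyAdmissible [DecidableEq ι] (X : InfWord ι) : Prop :=
  ∃ k, S.AdmissibleInf (X.shift k)

/-- The system `𝒦` has independent generators if the (non-empty) domain of every
admissible infinite word consists of exactly one point. -/
def IndependentGenerators [DecidableEq ι] : Prop :=
  ∀ X : InfWord ι, S.AdmissibleInf X → ∃ x : K, S.domInf X = {x}

/-- The admissible laminary language `ℒ_adm(𝒦)`: the largest laminary language consisting of
admissible words; `w ∈ ℒ_adm(𝒦)` iff for every `k` the word `w` is obtained from some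
admissible word `v` by deleting its prefix and its suffix of length `k`. -/
def admLanguage [DecidableEq ι] : Set (FreeGroup ι) :=
  {w | ∀ k : ℕ, ∃ v : FreeGroup ι, S.Admissible v ∧
      ∃ p s : List (ι × Bool), p.length = k ∧ s.length = k ∧
        v.toWord = p ++ w.toWord ++ s}

end SystemOfIsometries

/-- The ℝ-tree `T_𝒦` associated to a system of isometries `𝒦 = (K, 𝒜)`, presented through
its characteristic properties (Theorem 3.2 of the paper, by which it is unique):
`T_𝒦` contains `K` as an isometrically embedded subtree (1); the left action of `F(𝒜)`
is compatible with the partial isometries (2); every orbit meets `K`, and indeed every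
segment is covered by finitely many translates of `K` (3); and `T_𝒦` is universal among
trees satisfying (1) and (2), via unique equivariant morphisms (4). -/
structure AssocTree {K : Type} [MetricSpace K] {ι : Type} [DecidableEq ι]
    (S : SystemOfIsometries K ι) where
  carrier : Type
  [ms : MetricSpace carrier]
  tree : IsRTree carrier
  [act : MulAction (FreeGroup ι) carrier]
  act_isom : ∀ g : FreeGroup ι, Isometry fun x : carrier => g • x
  emb : K → carrier
  emb_isom : Isometry emb
  emb_subtree : IsSubtree (Set.range emb)
  compat : ∀ i : ι, ∀ x ∈ (S.pe i).source, (FreeGroup.of i)⁻¹ • emb x = emb (S.pe i x)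
  orbit_meets : ∀ p : carrier, ∃ (w : FreeGroup ι) (x : K), p = w • emb x
  seg_cover : ∀ p q : carrier, ∃ F : Finset (FreeGroup ι),
      seg p q ⊆ ⋃ w ∈ F, w • Set.range emb
  universal : ∀ (T' : Type) [MetricSpace T'] [MulAction (FreeGroup ι) T'],
      (∀ g : FreeGroup ι, Isometry fun x : T' => g • x) →
      ∀ e' : K → T', Isometry e' →
      (∀ i : ι, ∀ x ∈ (S.pe i).source, (FreeGroup.of i)⁻¹ • e' x = e' (S.pe i x)) →
      ∃! f : carrier → T', IsTreeMorphism f ∧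
        (∀ (g : FreeGroup ι) (p : carrier), f (g • p) = g • f p) ∧
        ∀ x : K, f (emb x) = e' x

attribute [instance] AssocTree.ms AssocTree.act

/-! ### Very small minimal actions with dense orbits, and their metric completion -/

/-- An ℝ-tree `T` (here: the subtree `Tsub` of the complete ℝ-tree `Tb`, whose metric
completion `T̄` is `Tb`) with a very small, minimal, isometric action of the free group
`F(𝒜)` with dense orbits.  (For actions with dense orbits, "very small" is equivalent to
"trivial arc stabilizers".) -/
structure TreeSetup (ι : Type) where
  Tb : Type
  [ms : MetricSpace Tb]
  complete : CompleteSpace Tb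
  tree : IsRTree Tb
  [act : MulAction (FreeGroup ι) Tb]
  act_isom : ∀ g : FreeGroup ι, Isometry fun x : Tb => g • x
  Tsub : Set Tb
  nonempty : Tsub.Nonempty
  dense : Dense Tsub
  sub_subtree : IsSubtree Tsub
  invariant : ∀ g : FreeGroup ι, ∀ x ∈ Tsub, g • x ∈ Tsub
  minimal : ∀ A : Set Tb, A ⊆ Tsub → A.Nonempty → IsSubtree A →
      (∀ g : FreeGroup ι, ∀ x ∈ A, g • x ∈ A) → A = Tsub
  dense_orbits : ∀ x ∈ Tsub, Tsub ⊆ closure (Set.range fun g : FreeGroup ι => g • x)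
  arc_stab : ∀ g : FreeGroup ι, ∀ x ∈ Tsub, ∀ y ∈ Tsub, x ≠ y →
      (fun p => g • p) '' seg x y = seg x y → g = 1

attribute [instance] TreeSetup.ms TreeSetup.act

/-- `𝒬(X) = Q` (for `Q ∈ T̄`), where `𝒬 : ∂F_N → T̂` is the map of Levitt–Lustig:
it is characterized by the property that whenever a sequence `uₙ ∈ F_N` converges to
`X ∈ ∂F_N` and `uₙ P` converges metrically in `T̄` to a point `Q`, then `𝒬(X) = Q`. -/
def QRel {ι : Type} [DecidableEq ι] (St : TreeSetup ι) (X : InfWord ι) (Q : St.Tb) : Prop :=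
  ∃ P ∈ St.Tsub, ∃ u : ℕ → FreeGroup ι, TendstoBoundary u X ∧
    Tendsto (fun n => u n • P) atTop (𝓝 Q)

/-- The limit set `Ω_𝒜 = 𝒬²(C²_𝒜 ∩ L²(T)) ⊆ T̄`: images of pairs of distinct boundary
points with distinct first letters (w.r.t. the basis `𝒜`) that are identified by `𝒬`. -/
def limitSet {ι : Type} [DecidableEq ι] (St : TreeSetup ι) : Set St.Tb :=
  {Q | ∃ X Y : InfWord ι, X.letter 0 ≠ Y.letter 0 ∧ QRel St X Q ∧ QRel St Y Q}

/-- The heart `K_𝒜 ⊆ T̄`: the convex hull of the limit set `Ω_𝒜`. -/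
def heart {ι : Type} [DecidableEq ι] (St : TreeSetup ι) : Set St.Tb :=
  subtreeHull (limitSet St)

/-- The dual algebraic lamination `L²(T) = {(X,Y) ∈ ∂²F_N : 𝒬(X) = 𝒬(Y)}`. -/
def L2 {ι : Type} [DecidableEq ι] (St : TreeSetup ι) : Set (InfWord ι × InfWord ι) :=
  {p | p.1 ≠ p.2 ∧ ∃ Q : St.Tb, QRel St p.1 Q ∧ QRel St p.2 Q}

/-! ### The system of isometries induced on a compact subtree `K ⊆ T̄` -/

/-- The domain, inside `T̄`, of the partial isometry `x ↦ w⁻¹ x` of `K` induced by the word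
`w`: the intersection of the translates of `K` by the prefixes of `w`. -/
def inducedDom {ι : Type} [DecidableEq ι] (St : TreeSetup ι) (K : Set St.Tb)
    (w : FreeGroup ι) : Set St.Tb :=
  ⋂ n ∈ Finset.range (w.toWord.length + 1), gprefix w n • K

/-- Admissibility of a word for the induced system of isometries `𝒦 = (K, 𝒜)`. -/
def InducedAdmissible {ι : Type} [DecidableEq ι] (St : TreeSetup ι) (K : Set St.Tb)
    (w : FreeGroup ι) : Prop :=
  (inducedDom St K w).Nonempty

/-- The admissible laminary language `ℒ_adm(𝒦)` of the induced system `𝒦 = (K, 𝒜)`. -/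
def inducedAdmLanguage {ι : Type} [DecidableEq ι] (St : TreeSetup ι) (K : Set St.Tb) :
    Set (FreeGroup ι) :=
  {w | ∀ k : ℕ, ∃ v : FreeGroup ι, InducedAdmissible St K v ∧
      ∃ p s : List (ι × Bool), p.length = k ∧ s.length = k ∧
        v.toWord = p ++ w.toWord ++ s}

/-- Admissibility of an infinite word for the induced system `𝒦 = (K, 𝒜)`. -/
def InducedAdmissibleInf {ι : Type} [DecidableEq ι] (St : TreeSetup ι) (K : Set St.Tb)
    (X : InfWord ι) : Prop :=
  ∀ n, InducedAdmissible St K (X.prefixN n)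

/-- The domain `dom(X) = ⋂ₙ dom(Xₙ)` of an infinite word, for the induced system. -/
def inducedDomInf {ι : Type} [DecidableEq ι] (St : TreeSetup ι) (K : Set St.Tb)
    (X : InfWord ι) : Set St.Tb :=
  ⋂ n, X.prefixN n • K

/-- Compatibility of a map `e : K → T'` with the system of partial isometries induced on
`K ⊆ T̄` by the basis `𝒜`: this is condition (2) of Theorem 3.2 for the induced system. -/
def InducedCompat {ι : Type} (St : TreeSetup ι) (K : Set St.Tb) {T' : Type} [MetricSpace T']
    [MulAction (FreeGroup ι) T'] (e : K → T') : Prop :=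
  ∀ (i : ι) (x : K) (h : (FreeGroup.of i)⁻¹ • (x : St.Tb) ∈ K),
    (FreeGroup.of i)⁻¹ • e x = e ⟨(FreeGroup.of i)⁻¹ • (x : St.Tb), h⟩

/-- The tree `T_𝒦` associated to the system of isometries induced on a compact subtree
`K ⊆ T̄`, presented through the characteristic properties of Theorem 3.2 (by which it is
unique), together with the canonical `F(𝒜)`-equivariant morphism `j : T_𝒦 → T̄` restricting
to the identity on `K`. -/
structure InducedAssoc {ι : Type} (St : TreeSetup ι) (K : Set St.Tb) where
  TK : Type
  [ms : MetricSpace TK]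
  tree : IsRTree TK
  [act : MulAction (FreeGroup ι) TK]
  act_isom : ∀ g : FreeGroup ι, Isometry fun x : TK => g • x
  emb : K → TK
  emb_isom : Isometry emb
  emb_subtree : IsSubtree (Set.range emb)
  compat : InducedCompat St K emb
  orbit_meets : ∀ p : TK, ∃ (w : FreeGroup ι) (x : K), p = w • emb x
  seg_cover : ∀ p q : TK, ∃ F : Finset (FreeGroup ι),
      seg p q ⊆ ⋃ w ∈ F, w • Set.range emb
  universal : ∀ (T' : Type) [MetricSpace T'] [MulAction (FreeGroup ι) T'],
      (∀ g : FreeGroup ι, Isometry fun x : T' => g • x) →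
      ∀ e' : K → T', Isometry e' → InducedCompat St K e' →
      ∃! f : TK → T', IsTreeMorphism f ∧
        (∀ (g : FreeGroup ι) (p : TK), f (g • p) = g • f p) ∧
        ∀ x : K, f (emb x) = e' x
  jmap : TK → St.Tb
  jmap_morphism : IsTreeMorphism jmap
  jmap_equivariant : ∀ (g : FreeGroup ι) (p : TK), jmap (g • p) = g • jmap p
  jmap_emb : ∀ x : K, jmap (emb x) = (x : St.Tb)

attribute [instance] InducedAssoc.ms InducedAssoc.act

/-! ### Change of basis -/

/-- Changing the basis of the free group: the same tree, with the action precomposed with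
the automorphism `φ` of `F(𝒜)`.  The heart of `St.twist φ` is the heart of `T` with respect
to the basis `φ(𝒜)`. -/
def TreeSetup.twist {ι : Type} (St : TreeSetup ι) (φ : FreeGroup ι ≃* FreeGroup ι) :
    TreeSetup ι where
  Tb := St.Tb
  ms := St.ms
  complete := St.complete
  tree := St.tree
  act := { smul := fun g x => φ g • x
           one_smul := fun x => by show φ 1 • x = x; rw [map_one, one_smul]
           mul_smul := fun g h x => by
             show φ (g * h) • x = φ g • φ h • x
             rw [map_mul, mul_smul] }
  act_isom := fun g => St.act_isom (φ g)
  Tsub := St.Tsub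
  nonempty := St.nonempty
  dense := St.dense
  sub_subtree := St.sub_subtree
  invariant := fun g x hx => St.invariant (φ g) x hx
  minimal := fun A hA hne hsub hinv => St.minimal A hA hne hsub (fun g x hx => by
    have h : φ (φ.symm g) • x ∈ A := hinv (φ.symm g) x hx
    rwa [MulEquiv.apply_symm_apply] at h)
  dense_orbits := fun x hx => by
    have hr : (Set.range fun g : FreeGroup ι => φ g • x) =
        Set.range fun g : FreeGroup ι => g • x := by
      apply Set.ext; intro y
      constructor
      · rintro ⟨g, rfl⟩; exact ⟨φ g, rfl⟩
      · rintro ⟨g, rfl⟩; exact ⟨φ.symm g, by simp⟩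
    show St.Tsub ⊆ closure (Set.range fun g : FreeGroup ι => φ g • x)
    rw [hr]; exact St.dense_orbits x hx
  arc_stab := fun g x hx y hy hxy him => by
    have h1 : φ g = 1 := St.arc_stab (φ g) x hx y hy hxy him
    have h2 := congrArg φ.symm h1
    simpa using h2

/-! ### The boundary `∂T`, the space `T̂ = T̄ ∪ ∂T` and the observers' topology -/

/-- An isometric ray (parametrized on `[0,∞)`) in a metric space. -/
def IsRay {T : Type} [MetricSpace T] (r : ℝ → T) : Prop :=
  ∀ s t : ℝ, 0 ≤ s → 0 ≤ t → dist (r s) (r t) = |s - t|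

/-- The type of isometric rays in `T`. -/
def Ray (T : Type) [MetricSpace T] : Type := {r : ℝ → T // IsRay r}

/-- Two rays define the same end iff they are at bounded distance. -/
def rayEnd (T : Type) [MetricSpace T] : Setoid (Ray T) where
  r := fun r₁ r₂ => ∃ C : ℝ, ∀ t : ℝ, 0 ≤ t → dist (r₁.1 t) (r₂.1 t) ≤ C
  iseqv := by
    refine ⟨fun r => ⟨0, fun t _ => by simp⟩, ?_, ?_⟩
    · rintro r₁ r₂ ⟨C, hC⟩
      exact ⟨C, fun t ht => by rw [dist_comm]; exact hC t ht⟩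
    · rintro r₁ r₂ r₃ ⟨C, hC⟩ ⟨D, hD⟩
      exact ⟨C + D, fun t ht =>
        (dist_triangle _ (r₂.1 t) _).trans (add_le_add (hC t ht) (hD t ht))⟩

/-- The Gromov boundary `∂T`: ends of `T`, i.e. classes of rays at bounded distance. -/
def GromovBoundary (T : Type) [MetricSpace T] : Type := Quotient (rayEnd T)

/-- The space `T̂ = T̄ ∪ ∂T` (for `T` a complete ℝ-tree, representing the completion `T̄`). -/
def TreeHat (T : Type) [MetricSpace T] : Type := T ⊕ GromovBoundary T

/-- The segment `[x, ξ]` from a point `x ∈ T̄` to a boundary point `ξ ∈ ∂T`. -/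
def raySeg {T : Type} [MetricSpace T] (x : T) (ξ : GromovBoundary T) : Set (TreeHat T) :=
  ({Sum.inr ξ} : Set (TreeHat T)) ∪ Sum.inl ''
    {p | ∃ r : Ray T, Quotient.mk (rayEnd T) r = ξ ∧ r.1 0 = x ∧ ∃ t : ℝ, 0 ≤ t ∧ r.1 t = p}

/-- The segment `[ξ, η]` between two boundary points. -/
def lineSeg {T : Type} [MetricSpace T] (ξ η : GromovBoundary T) : Set (TreeHat T) :=
  ({Sum.inr ξ, Sum.inr η} : Set (TreeHat T)) ∪ Sum.inl ''
    {p | ∃ r r' : Ray T, Quotient.mk (rayEnd T) r = ξ ∧ Quotient.mk (rayEnd T) r' = η ∧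
      r.1 0 = p ∧ r'.1 0 = p ∧ ∀ s t : ℝ, 0 ≤ s → 0 ≤ t → dist (r.1 s) (r'.1 t) = s + t}

/-- The segment `[P, Q]` between two points of `T̂ = T̄ ∪ ∂T`. -/
def segHat {T : Type} [MetricSpace T] : TreeHat T → TreeHat T → Set (TreeHat T)
  | Sum.inl x, Sum.inl y => Sum.inl '' seg x y
  | Sum.inl x, Sum.inr ξ => raySeg x ξ
  | Sum.inr ξ, Sum.inl x => raySeg x ξ
  | Sum.inr ξ, Sum.inr η => lineSeg ξ η

/-- The observers' topology on `T̂`: generated by the set of directions, where the direction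
at `P` containing `x` is the set of points `y` with `P ∉ [x,y]` (i.e. the connected component
of `T̂ ∖ {P}` containing `x`). -/
def observersTopology (T : Type) [MetricSpace T] : TopologicalSpace (TreeHat T) :=
  TopologicalSpace.generateFrom
    {D | ∃ P x : TreeHat T, x ≠ P ∧ D = {y | y ≠ P ∧ P ∉ segHat x y}}

/-- The extension to `T̂ = T̄ ∪ ∂T` of an isometric action on `T̄`. -/
def TreeHat.smul {T : Type} [MetricSpace T] {G : Type} [Group G] [MulAction G T]
    (hiso : ∀ g : G, Isometry fun x : T => g • x) (g : G) : TreeHat T → TreeHat T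
  | Sum.inl x => Sum.inl (g • x)
  | Sum.inr ξ => Sum.inr <| Quotient.map'
      (fun r : Ray T => (⟨fun t => g • r.1 t, fun s t hs ht => by
        have h := (hiso g).dist_eq (r.1 s) (r.1 t)
        simpa using h.trans (r.2 s t hs ht)⟩ : Ray T))
      (fun r r' h => by
        obtain ⟨C, hC⟩ := h
        exact ⟨C, fun t ht => by
          have h' := (hiso g).dist_eq (r.1 t) (r'.1 t)
          simpa using h'.le.trans (hC t ht)⟩) ξ

/-! ### Laminations -/

/-- An algebraic lamination (as a set of pairs of boundary points) is closed by diagonal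
leaves. -/
def ClosedByDiagonal {ι : Type} (L : Set (InfWord ι × InfWord ι)) : Prop :=
  ∀ X X' X'' : InfWord ι, (X, X') ∈ L → (X', X'') ∈ L → X = X'' ∨ (X, X'') ∈ L

/-- Invariance of a lamination under the `F(𝒜)`-action on `∂²F(𝒜)`. -/
def InvariantLam {ι : Type} [DecidableEq ι] (L : Set (InfWord ι × InfWord ι)) : Prop :=
  ∀ (w : FreeGroup ι) (X X' Y Y' : InfWord ι), (X, X') ∈ L →
    SmulBoundary w X Y → SmulBoundary w X' Y' → (Y, Y') ∈ L

/-- Invariance of a lamination under the flip map. -/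
def FlipInvariant {ι : Type} (L : Set (InfWord ι × InfWord ι)) : Prop :=
  ∀ X Y : InfWord ι, (X, Y) ∈ L → (Y, X) ∈ L

/-- The dual lamination `L²(T)` is minimal up to diagonal leaves: it contains no proper
non-trivial sublamination that is closed by diagonal leaves. -/
def MinimalUpToDiagonal {ι : Type} [DecidableEq ι] (St : TreeSetup ι) : Prop :=
  ∀ L : Set (InfWord ι × InfWord ι), L ⊆ L2 St → L.Nonempty → IsClosed L →
    InvariantLam L → FlipInvariant L → ClosedByDiagonal L → L = L2 St

end CHL

namespace CHL

/-- `u` is the maximal common prefix of the reduced words `w` and `w'`. -/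
def IsMaxCommonPrefix {ι : Type} [DecidableEq ι] (w w' u : FreeGroup ι) : Prop :=
  ∃ k : ℕ, k ≤ w.toWord.length ∧ k ≤ w'.toWord.length ∧
    u = gprefix w k ∧ w.toWord.take k = w'.toWord.take k ∧
    ∀ j : ℕ, j ≤ w.toWord.length → j ≤ w'.toWord.length →
      w.toWord.take j = w'.toWord.take j → j ≤ k

/-! ### Chain pseudodistances along words -/

namespace SystemOfIsometries

variable {K : Type*} [MetricSpace K] {ι : Type*} (S : SystemOfIsometries K ι)

/-- The inverse of a letter of `𝒜^{±1}`. -/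
def invLetter (z : ι × Bool) : ι × Bool := (z.1, !z.2)

lemma letterPE_invLetter (z : ι × Bool) : S.letterPE (invLetter z) = (S.letterPE z).symm := by
  obtain ⟨i, _ | _⟩ := z <;> simp [invLetter, letterPE]

lemma isClosedSubtree_letterPE_source (z : ι × Bool) :
    IsClosedSubtree (S.letterPE z).source := by
  obtain ⟨i, _ | _⟩ := z
  · simpa [letterPE] using S.target_subtree i
  · simpa [letterPE] using S.source_subtree i

instance (z : ι × Bool) : Nonempty (S.letterPE z).source :=
  (S.isClosedSubtree_letterPE_source z).1.to_subtype

lemma dist_letterPE (z : ι × Bool) {x y : K} (hx : x ∈ (S.letterPE z).source)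
    (hy : y ∈ (S.letterPE z).source) :
    dist (S.letterPE z x) (S.letterPE z y) = dist x y := by
  obtain ⟨i, _ | _⟩ := z
  · simp only [letterPE, PartialEquiv.symm_source] at hx hy ⊢
    have h := S.isom i _ ((S.pe i).map_target hx) _ ((S.pe i).map_target hy)
    rw [(S.pe i).right_inv hx, (S.pe i).right_inv hy] at h
    exact h.symm
  · exact S.isom i x hx y hy

/-- The infimum of the lengths of the paths from `x` to `y` in the copies of `K` glued
successively along the partial isometries given by the letters of the word `L`. -/
def chainDist : List (ι × Bool) → K → K → ℝ
  | [], x, y => dist x y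
  | z :: L, x, y => ⨅ p : (S.letterPE z).source, (dist x p + chainDist L (S.letterPE z p) y)

lemma chainDist_nonneg (L : List (ι × Bool)) (x y : K) : 0 ≤ S.chainDist L x y := by
  induction L generalizing x with
  | nil => exact dist_nonneg
  | cons z L ih => exact Real.iInf_nonneg fun p => add_nonneg dist_nonneg (ih _)

lemma chainDist_cons_le {z : ι × Bool} {p : K} (hp : p ∈ (S.letterPE z).source)
    (L : List (ι × Bool)) (x y : K) :
    S.chainDist (z :: L) x y ≤ dist x p + S.chainDist L (S.letterPE z p) y := by
  refine ciInf_le (f := fun q : (S.letterPE z).source =>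
    dist x q + S.chainDist L (S.letterPE z q) y) ⟨0, ?_⟩ ⟨p, hp⟩
  rintro _ ⟨q, rfl⟩
  exact add_nonneg dist_nonneg (S.chainDist_nonneg _ _ _)

lemma le_chainDist_cons {z : ι × Bool} {L : List (ι × Bool)} {x y : K} {r : ℝ}
    (h : ∀ p ∈ (S.letterPE z).source, r ≤ dist x p + S.chainDist L (S.letterPE z p) y) :
    r ≤ S.chainDist (z :: L) x y :=
  le_ciInf fun p => h p p.2

lemma chainDist_le_dist_add (L : List (ι × Bool)) (x x' y : K) :
    S.chainDist L x y ≤ dist x x' + S.chainDist L x' y := by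
  cases L with
  | nil => exact dist_triangle _ _ _
  | cons z L =>
    rw [← sub_le_iff_le_add']
    refine S.le_chainDist_cons fun p hp => ?_
    linarith [S.chainDist_cons_le hp L x y, dist_triangle x x' p]

lemma chainDist_triangle (L L' : List (ι × Bool)) (x y y' : K) :
    S.chainDist (L ++ L') x y' ≤ S.chainDist L x y + S.chainDist L' y y' := by
  induction L generalizing x with
  | nil => exact S.chainDist_le_dist_add _ _ _ _
  | cons z L ih =>
    rw [List.cons_append, ← sub_le_iff_le_add]
    refine S.le_chainDist_cons fun p hp => ?_
    linarith [S.chainDist_cons_le hp (L ++ L') x y', ih (S.letterPE z p)]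

lemma chainDist_append_mono {L' L'' : List (ι × Bool)} {y : K}
    (h : ∀ x, S.chainDist L' x y ≤ S.chainDist L'' x y) (L : List (ι × Bool)) (x : K) :
    S.chainDist (L ++ L') x y ≤ S.chainDist (L ++ L'') x y := by
  induction L generalizing x with
  | nil => exact h x
  | cons z L ih =>
    rw [List.cons_append, List.cons_append]
    refine S.le_chainDist_cons fun p hp => ?_
    linarith [S.chainDist_cons_le hp (L ++ L') x y, ih (S.letterPE z p)]

lemma chainDist_le_cons_invLetter (z : ι × Bool) (L : List (ι × Bool)) (x y : K) :
    S.chainDist L x y ≤ S.chainDist (z :: invLetter z :: L) x y := by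
  refine S.le_chainDist_cons fun p hp => ?_
  rw [← sub_le_iff_le_add']
  refine S.le_chainDist_cons fun q hq => ?_
  rw [letterPE_invLetter] at hq ⊢
  have hq' := (S.letterPE z).map_target hq
  have h := S.dist_letterPE z hp hq'
  rw [(S.letterPE z).right_inv hq] at h
  have h₁ := S.chainDist_le_dist_add L x ((S.letterPE z).symm q) y
  linarith [dist_triangle x p ((S.letterPE z).symm q)]

lemma chainDist_le_of_red {L L' : List (ι × Bool)} (h : FreeGroup.Red L L') (x y : K) :
    S.chainDist L' x y ≤ S.chainDist L x y := by
  induction h with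
  | refl => exact le_rfl
  | tail _ hs ih =>
    refine le_trans ?_ ih
    obtain ⟨⟩ := hs
    exact S.chainDist_append_mono (fun x => S.chainDist_le_cons_invLetter _ _ _ _) _ _

lemma chainDist_invRev_le (L : List (ι × Bool)) (x y : K) :
    S.chainDist (FreeGroup.invRev L) y x ≤ S.chainDist L x y := by
  induction L generalizing x with
  | nil => exact (dist_comm y x).le
  | cons z L ih =>
    refine S.le_chainDist_cons fun p hp => ?_
    rw [FreeGroup.invRev_cons]
    have h₁ := S.chainDist_triangle (FreeGroup.invRev L) (FreeGroup.invRev [z]) y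
      (S.letterPE z p) x
    have h₂ : S.chainDist (FreeGroup.invRev [z]) (S.letterPE z p) x ≤ dist x p := by
      have hp' : S.letterPE z p ∈ (S.letterPE (invLetter z)).source := by
        rw [letterPE_invLetter]
        exact (S.letterPE z).map_source hp
      have h := S.chainDist_cons_le hp' [] (S.letterPE z p) x
      rw [dist_self, zero_add, letterPE_invLetter, (S.letterPE z).left_inv hp] at h
      exact h.trans (dist_comm p x).le
    linarith [ih (S.letterPE z p)]

lemma chainDist_invRev (L : List (ι × Bool)) (x y : K) :
    S.chainDist (FreeGroup.invRev L) y x = S.chainDist L x y :=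
  le_antisymm (S.chainDist_invRev_le L x y) <| by
    simpa using S.chainDist_invRev_le (FreeGroup.invRev L) y x

lemma eq_zero_of_chainDist_cons_eq_zero [CompactSpace K] {z : ι × Bool} {L : List (ι × Bool)}
    {x y : K} (h : S.chainDist (z :: L) x y = 0) :
    x ∈ (S.letterPE z).source ∧ S.chainDist L (S.letterPE z x) y = 0 := by
  obtain ⟨hne, hcl, -⟩ := S.isClosedSubtree_letterPE_source z
  have hcont : ContinuousOn (fun p => dist x p + S.chainDist L (S.letterPE z p) y)
      (S.letterPE z).source := by
    have : LipschitzOnWith 1 (fun p => S.chainDist L (S.letterPE z p) y)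
        (S.letterPE z).source := by
      refine LipschitzOnWith.of_le_add fun p hp q hq => ?_
      rw [← S.dist_letterPE z hp hq, add_comm]
      exact S.chainDist_le_dist_add _ _ _ _
    exact (continuous_const.dist continuous_id).continuousOn.add this.continuousOn
  obtain ⟨p, hp, hmin⟩ := hcl.isCompact.exists_isMinOn hne hcont
  have h₀ : dist x p + S.chainDist L (S.letterPE z p) y ≤ 0 :=
    h ▸ S.le_chainDist_cons fun q hq => hmin hq
  have h₁ := S.chainDist_nonneg L (S.letterPE z p) y
  have hxp : x = p := dist_le_zero.1 (by linarith)
  subst hxp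
  exact ⟨hp, le_antisymm (by linarith [dist_nonneg (x := x) (y := x)]) h₁⟩

/-- The space `F(𝒜) × K`, carrying the chain pseudodistance. -/
def GluedSpace (_S : SystemOfIsometries K ι) : Type _ := FreeGroup ι × K

variable [DecidableEq ι]

instance : PseudoMetricSpace S.GluedSpace where
  dist a b := S.chainDist (a.1⁻¹ * b.1).toWord a.2 b.2
  dist_self a := by
    simp [chainDist]
  dist_comm a b := by
    rw [← chainDist_invRev, ← FreeGroup.toWord_inv]
    simp
  dist_triangle a b c := by
    refine le_trans ?_ (S.chainDist_triangle _ _ _ _ _)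
    have : a.1⁻¹ * c.1 = (a.1⁻¹ * b.1) * (b.1⁻¹ * c.1) := by group
    rw [this, FreeGroup.toWord_mul]
    exact S.chainDist_le_of_red FreeGroup.reduce.red _ _

lemma GluedSpace.dist_def (a b : S.GluedSpace) :
    dist a b = S.chainDist (a.1⁻¹ * b.1).toWord a.2 b.2 := rfl

instance : MulAction (FreeGroup ι) S.GluedSpace where
  smul g a := (g * a.1, a.2)
  one_smul a := Prod.ext (one_mul a.1) rfl
  mul_smul g h a := Prod.ext (mul_assoc g h a.1) rfl

instance : IsIsometricSMul (FreeGroup ι) S.GluedSpace where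
  isometry_smul g := by
    refine Isometry.of_dist_eq fun a b => ?_
    change S.chainDist ((g * a.1)⁻¹ * (g * b.1)).toWord a.2 b.2 = dist a b
    rw [GluedSpace.dist_def]
    congr 2
    group

instance : IsIsometricSMul (FreeGroup ι) (SeparationQuotient S.GluedSpace) where
  isometry_smul g := by
    refine Isometry.of_dist_eq fun a b => ?_
    obtain ⟨a, rfl⟩ := SeparationQuotient.surjective_mk a
    obtain ⟨b, rfl⟩ := SeparationQuotient.surjective_mk b
    rw [← SeparationQuotient.mk_smul, ← SeparationQuotient.mk_smul, SeparationQuotient.dist_mk,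
      SeparationQuotient.dist_mk, dist_smul]

end SystemOfIsometries

/-! ### Coincidences between translates of `K` -/

namespace AssocTree

variable {K : Type} [MetricSpace K] {ι : Type} [DecidableEq ι]
  {S : SystemOfIsometries K ι} (A : AssocTree S)

open SystemOfIsometries

instance : IsRTree A.carrier := A.tree

instance : IsIsometricSMul (FreeGroup ι) A.carrier := ⟨A.act_isom⟩

lemma chainDist_eq_zero {w : FreeGroup ι} {x y : K} (h : A.emb x = w • A.emb y) :
    S.chainDist w.toWord x y = 0 := by
  let pt : FreeGroup ι → K → S.GluedSpace := fun g x => (g, x)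
  obtain ⟨f, ⟨-, hf, hfe⟩, -⟩ := A.universal (SeparationQuotient S.GluedSpace)
    (fun g => isometry_smul _ g) (fun x => SeparationQuotient.mk (pt 1 x))
    (Isometry.of_dist_eq fun x y => by
      rw [SeparationQuotient.dist_mk, GluedSpace.dist_def]
      simp [pt, chainDist])
    (fun i x hx => by
      rw [← SeparationQuotient.mk_smul, ← dist_le_zero, SeparationQuotient.dist_mk,
        GluedSpace.dist_def]
      change S.chainDist (((FreeGroup.of i)⁻¹ * 1)⁻¹ * 1).toWord x (S.pe i x) ≤ 0
      have h := S.chainDist_cons_le (z := (i, true)) (p := x) hx [] x (S.pe i x)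
      simpa [chainDist, letterPE] using h)
  have h' := congrArg f h
  rw [hf, hfe, hfe, ← SeparationQuotient.mk_smul, ← dist_eq_zero, SeparationQuotient.dist_mk,
    GluedSpace.dist_def] at h'
  change S.chainDist ((1 : FreeGroup ι)⁻¹ * (w * 1)).toWord x y = 0 at h'
  simpa using h'

lemma emb_eq_letter_smul_emb (z : ι × Bool) {x : K} (hx : x ∈ (S.letterPE z).source) :
    A.emb x = FreeGroup.mk [z] • A.emb (S.letterPE z x) := by
  obtain ⟨i, _ | _⟩ := z
  · have hx' : x ∈ (S.pe i).target := hx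
    have h := A.compat i _ ((S.pe i).map_target hx')
    rw [(S.pe i).right_inv hx'] at h
    rw [← h]
    simp [FreeGroup.of, FreeGroup.inv_mk, FreeGroup.invRev, letterPE]
  · change _ = FreeGroup.of i • A.emb (S.pe i x)
    rw [← A.compat i x hx, smul_inv_smul]

lemma exists_emb_eq_mk_smul [CompactSpace K] (L L' : List (ι × Bool)) {x y : K}
    (h : S.chainDist (L ++ L') x y = 0) : ∃ x', A.emb x = FreeGroup.mk L • A.emb x' := by
  induction L generalizing x with
  | nil => exact ⟨x, by rw [← FreeGroup.one_eq_mk, one_smul]⟩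
  | cons z L ih =>
    obtain ⟨hx, h'⟩ := S.eq_zero_of_chainDist_cons_eq_zero h
    obtain ⟨x', hx'⟩ := ih h'
    refine ⟨x', ?_⟩
    rw [A.emb_eq_letter_smul_emb z hx, hx', smul_smul, FreeGroup.mul_mk, List.singleton_append]

end AssocTree

/-- Two reduced words can be concatenated after inverting the first one when they start with
different letters. -/
lemma toWord_inv_mul_of_head?_ne {ι : Type*} [DecidableEq ι] {g h : FreeGroup ι}
    (hne : g.toWord.head? ≠ h.toWord.head?) :
    (g⁻¹ * h).toWord = g⁻¹.toWord ++ h.toWord := by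
  rw [FreeGroup.toWord_mul]
  refine FreeGroup.IsReduced.reduce_eq ?_
  refine List.IsChain.append FreeGroup.isReduced_toWord FreeGroup.isReduced_toWord ?_
  rw [FreeGroup.toWord_inv]
  intro a ha b hb hab
  by_contra hab'
  apply hne
  have hh : g.toWord.head? = some (a.1, !a.2) := by
    cases hg : g.toWord with
    | nil => simp [hg] at ha
    | cons c l =>
      rw [hg] at ha
      simp only [FreeGroup.invRev, List.map_cons, List.reverse_cons, List.getLast?_append,
        List.getLast?_singleton, Option.some_or, Option.mem_some_iff] at ha
      simp [← ha]
  rw [hh, Option.mem_def.1 hb]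
  obtain ⟨a₁, a₂⟩ := a
  obtain ⟨b₁, b₂⟩ := b
  cases a₂ <;> cases b₂ <;> simp_all

lemma head?_invRev_ne_head? {ι : Type*} {L L' : List (ι × Bool)} (hL : L ≠ [])
    (h : FreeGroup.IsReduced (L ++ L')) : (FreeGroup.invRev L).head? ≠ L'.head? := by
  obtain ⟨L, z, rfl⟩ := List.eq_nil_or_concat L |>.resolve_left hL
  cases L' with
  | nil => simp [FreeGroup.invRev]
  | cons z' L' =>
    intro heq
    have heq' : (z.1, !z.2) = z' := by simpa [FreeGroup.invRev] using heq
    have hr : FreeGroup.IsReduced [z, z'] := h.infix ⟨L, L', by simp⟩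
    simp [FreeGroup.IsReduced, ← heq'] at hr

/-! ### Segments and medians in `ℝ`-trees -/

section RTree

variable {T : Type*} [MetricSpace T]

lemma mem_seg {x y z : T} : z ∈ seg x y ↔ dist x z + dist z y = dist x y := Iff.rfl

lemma seg_comm (x y : T) : seg x y = seg y x := by
  ext z
  rw [mem_seg, mem_seg, dist_comm y z, dist_comm z x, dist_comm y x, add_comm]

lemma mem_seg_of_mem_seg {x y P a b : T} (hP : P ∈ seg x y) (ha : a ∈ seg x P)
    (hb : b ∈ seg P y) : P ∈ seg a b := by
  rw [mem_seg] at hP ha hb ⊢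
  linarith [dist_triangle a P b, dist_triangle x a y, dist_triangle a b y]

variable [IsRTree T]

lemma exists_path_in_seg (p q : T) :
    ∃ C ⊆ seg p q, IsPreconnected C ∧ p ∈ C ∧ q ∈ C := by
  obtain ⟨f, h₀, h₁, hf⟩ := IsRTree.geodesic p q
  have hd : (0 : ℝ) ≤ dist p q := dist_nonneg
  refine ⟨f '' Icc 0 (dist p q), ?_, ?_, ⟨0, ⟨le_rfl, hd⟩, h₀⟩, ⟨_, ⟨hd, le_rfl⟩, h₁⟩⟩
  · rintro _ ⟨t, ht, rfl⟩
    have h₂ := hf 0 ⟨le_rfl, hd⟩ t ht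
    have h₃ := hf t ht _ ⟨hd, le_rfl⟩
    rw [h₀, zero_sub, abs_neg, abs_of_nonneg ht.1] at h₂
    rw [h₁, abs_sub_comm, abs_of_nonneg (sub_nonneg.2 ht.2)] at h₃
    rw [mem_seg, h₂, h₃]
    ring
  · refine isPreconnected_Icc.image f (LipschitzOnWith.continuousOn (K := 1) ?_)
    refine LipschitzOnWith.of_dist_le_mul fun s hs t ht => ?_
    rw [hf s hs t ht, NNReal.coe_one, one_mul, Real.dist_eq]

lemma exists_median (x y z : T) :
    ∃ P, P ∈ seg x y ∧ P ∈ seg x z ∧ P ∈ seg y z := by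
  obtain ⟨f, h₀, h₁, hf⟩ := IsRTree.geodesic x y
  set t := (dist x y + dist x z - dist y z) / 2 with ht_def
  have hd : (0 : ℝ) ≤ dist x y := dist_nonneg
  have ht : t ∈ Icc 0 (dist x y) := by
    constructor
    · linarith [dist_triangle y x z, dist_comm x y]
    · linarith [dist_triangle x y z]
  have h₂ := hf 0 ⟨le_rfl, hd⟩ t ht
  have h₃ := hf t ht _ ⟨hd, le_rfl⟩
  rw [h₀, zero_sub, abs_neg, abs_of_nonneg ht.1] at h₂
  rw [h₁, abs_sub_comm, abs_of_nonneg (sub_nonneg.2 ht.2)] at h₃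
  have h₄ := IsRTree.four_point x y (f t) z
  have h₅ : dist x (f t) + dist y z = dist x z + dist y (f t) := by
    rw [h₂, dist_comm y (f t), h₃]
    linarith
  rw [h₅, dist_comm y (f t), max_self] at h₄
  have h₆ := dist_triangle x (f t) z
  have h₇ := dist_triangle y (f t) z
  rw [dist_comm y (f t)] at h₇
  refine ⟨f t, ?_, ?_, ?_⟩ <;> simp only [mem_seg]
  · linarith
  · linarith
  · rw [dist_comm y (f t)]
    linarith

lemma seg_inter_seg_eq {x y z P : T} (hy : P ∈ seg x y) (hz : P ∈ seg x z)
    (hyz : P ∈ seg y z) : seg x y ∩ seg x z = seg x P := by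
  simp only [mem_seg] at hy hz hyz
  ext q
  simp only [mem_inter_iff, mem_seg]
  constructor
  · rintro ⟨h₁, h₂⟩
    have h₃ := IsRTree.four_point y z q P
    have h₄ := dist_triangle x q P
    have := dist_comm P y
    have := dist_comm P z
    have := dist_comm q y
    have := dist_comm q z
    rcases le_max_iff.1 h₃ with h₃ | h₃ <;> linarith
  · intro h
    constructor
    · linarith [dist_triangle x q y, dist_triangle q P y]
    · linarith [dist_triangle x q z, dist_triangle q P z]

lemma mem_seg_or_mem_seg {x y a : T} (P : T) (ha : a ∈ seg x y) :
    a ∈ seg x P ∨ a ∈ seg P y := by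
  rw [mem_seg] at ha
  rw [mem_seg, mem_seg]
  have h := IsRTree.four_point x y a P
  have h₁ := dist_triangle x a P
  have h₂ := dist_triangle P a y
  have := dist_comm P a
  have := dist_comm y P
  have := dist_comm y a
  rcases le_max_iff.1 h with h | h
  · right; linarith
  · left; linarith

lemma IsSubtree.mem_of_mem_seg {B : Set T} (hB : IsSubtree B) {x y z P a b c : T}
    (hxy : P ∈ seg x y) (hxz : P ∈ seg x z) (hyz : P ∈ seg y z)
    (ha : a ∈ seg x y) (haB : a ∈ B) (hb : b ∈ seg x z) (hbB : b ∈ B)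
    (hc : c ∈ seg y z) (hcB : c ∈ B) : P ∈ B := by
  rcases mem_seg_or_mem_seg P ha with ha | ha
  · rcases mem_seg_or_mem_seg P hc with hc | hc
    · exact hB a haB c hcB (mem_seg_of_mem_seg hxy ha (seg_comm y P ▸ hc))
    · exact hB a haB c hcB (mem_seg_of_mem_seg hxz ha hc)
  · rcases mem_seg_or_mem_seg P hb with hb | hb
    · exact hB b hbB a haB (mem_seg_of_mem_seg hxy hb ha)
    · exact hB a haB b hbB (mem_seg_of_mem_seg hyz (seg_comm P y ▸ ha) hb)

end RTree

lemma smul_mem_seg {G T : Type*} [Group G] [MetricSpace T] [MulAction G T]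
    [IsIsometricSMul G T] (g : G) {x y z : T} (h : z ∈ seg x y) :
    g • z ∈ seg (g • x) (g • y) := by
  simpa [mem_seg] using h

namespace AssocTree

variable {K : Type} [MetricSpace K] [CompactSpace K] {ι : Type} [DecidableEq ι]
  {S : SystemOfIsometries K ι} (A : AssocTree S)

/-- A segment joining translates of `K` by words with different first letters meets `K`. -/
lemma exists_mem_seg_of_head? {g h : FreeGroup ι} {p q : A.carrier}
    (hgh : g.toWord.head? = h.toWord.head? → g = 1)
    (hp : p ∈ g • Set.range A.emb) (hq : q ∈ h • Set.range A.emb) :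
    ∃ r ∈ seg p q, r ∈ Set.range A.emb := by
  obtain ⟨C, hCseg, hC, hpC, hqC⟩ := exists_path_in_seg p q
  by_cases hg : g = 1
  · subst hg
    exact ⟨p, hCseg hpC, by simpa using hp⟩
  obtain ⟨F, hF⟩ := A.seg_cover p q
  have hclosed (v : FreeGroup ι) : IsClosed (v • Set.range A.emb) :=
    (isCompact_range A.emb_isom.continuous |>.smul v).isClosed
  let F' : Finset (FreeGroup ι) := insert g (insert h F)
  have hcl (P : FreeGroup ι → Prop) : IsClosed (⋃ v ∈ {v ∈ (F' : Set (FreeGroup ι)) | P v},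
      v • Set.range A.emb) :=
    (F'.finite_toSet.subset fun _ hv => hv.1).isClosed_biUnion fun v _ => hclosed v
  obtain ⟨r, hrC, hr₁, hr₂⟩ := isPreconnected_closed_iff.1 hC _ _
    (hcl fun v => v.toWord.head? = g.toWord.head?)
    (hcl fun v => v.toWord.head? ≠ g.toWord.head?)
    (fun r hr => by
      obtain ⟨v, hv, hrv⟩ := mem_iUnion₂.1 (hF (hCseg hr))
      have hvF : v ∈ F' := by simp [F', hv]
      by_cases hvg : v.toWord.head? = g.toWord.head?
      · exact Or.inl (mem_biUnion (show v ∈ {v | _ ∧ _} from ⟨hvF, hvg⟩) hrv)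
      · exact Or.inr (mem_biUnion (show v ∈ {v | _ ∧ _} from ⟨hvF, hvg⟩) hrv))
    ⟨p, hpC, mem_biUnion (show g ∈ {v | _ ∧ _} from ⟨by simp [F'], rfl⟩) hp⟩
    ⟨q, hqC, mem_biUnion (show h ∈ {v | _ ∧ _} from
      ⟨by simp [F'], fun heq => hg (hgh heq.symm)⟩) hq⟩
  obtain ⟨v, ⟨-, hv⟩, _, ⟨x, rfl⟩, rfl⟩ := mem_iUnion₂.1 hr₁
  obtain ⟨v', ⟨-, hv'⟩, _, ⟨y, rfl⟩, hxy⟩ := mem_iUnion₂.1 hr₂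
  simp only at hxy
  have hxy' : A.emb x = (v⁻¹ * v') • A.emb y := by
    rw [mul_smul, hxy, inv_smul_smul]
  have hword : (v⁻¹ * v').toWord = v⁻¹.toWord ++ v'.toWord :=
    toWord_inv_mul_of_head?_ne fun heq => hv' (heq ▸ hv)
  have hzero := A.chainDist_eq_zero hxy'
  rw [hword] at hzero
  obtain ⟨x', hx'⟩ := A.exists_emb_eq_mk_smul _ _ hzero
  refine ⟨_, hCseg hrC, x', ?_⟩
  simp only
  rw [hx', FreeGroup.mk_toWord, smul_inv_smul]

end AssocTree


/-- **Lemma 3.8.**  Let `w, w' ∈ F(𝒜)` have maximal common prefix `u`.  For any points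
`Q ∈ K`, `R ∈ wK`, `R' ∈ w'K` of `T_𝒦`, the intersection of the segments `[Q,R]` and
`[Q,R']` is a segment `[Q,P]` with endpoint `P ∈ uK`. -/
theorem center_in_common_prefix_translate (K : Type) [MetricSpace K] [CompactSpace K]
    [IsRTree K] (ι : Type) [Fintype ι] [DecidableEq ι] (S : SystemOfIsometries K ι)
    (A : AssocTree S) (w w' u : FreeGroup ι) (hu : IsMaxCommonPrefix w w' u)
    (Q R R' : A.carrier) (hQ : Q ∈ Set.range A.emb) (hR : R ∈ w • Set.range A.emb)
    (hR' : R' ∈ w' • Set.range A.emb) :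
    ∃ P ∈ u • Set.range A.emb, seg Q R ∩ seg Q R' = seg Q P := by
  obtain ⟨k, hk, hk', rfl, htake, hmax⟩ := hu
  set u := gprefix w k with hu
  have hred (v : FreeGroup ι) : FreeGroup.IsReduced (v.toWord.take k ++ v.toWord.drop k) := by
    rw [List.take_append_drop]
    exact FreeGroup.isReduced_toWord
  have hword_u : u.toWord = w.toWord.take k := by
    rw [hu, gprefix, FreeGroup.toWord_mk]
    exact ((hred w).infix (List.prefix_append _ _).isInfix).reduce_eq
  have hsplit (v : FreeGroup ι) (hv : w.toWord.take k = v.toWord.take k) :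
      (u⁻¹ * v).toWord = v.toWord.drop k := by
    have hmul : u⁻¹ * v = FreeGroup.mk (v.toWord.drop k) := by
      rw [inv_mul_eq_iff_eq_mul, hu, gprefix, FreeGroup.mul_mk, hv, List.take_append_drop,
        FreeGroup.mk_toWord]
    rw [hmul, FreeGroup.toWord_mk]
    exact ((hred v).infix (List.suffix_append _ _).isInfix).reduce_eq
  have hs := hsplit w rfl
  have hs' := hsplit w' htake
  have hmem (v : FreeGroup ι) {X : A.carrier} (hX : X ∈ v • Set.range A.emb) :
      u⁻¹ • X ∈ (u⁻¹ * v) • Set.range A.emb := by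
    rw [mul_smul]
    exact Set.smul_mem_smul_set hX
  have hQ' : u⁻¹ • Q ∈ u⁻¹ • Set.range A.emb := Set.smul_mem_smul_set hQ
  have hhead (v : FreeGroup ι) (hv : w.toWord.take k = v.toWord.take k)
      (heq : u⁻¹.toWord.head? = (u⁻¹ * v).toWord.head?) : u⁻¹ = 1 := by
    by_contra hne
    rw [hsplit v hv, FreeGroup.toWord_inv, hword_u, hv] at heq
    refine head?_invRev_ne_head? (fun hnil => hne ?_) (hred v) heq
    rw [inv_eq_one, ← FreeGroup.toWord_eq_nil_iff, hword_u, hv, hnil]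
  have hhead' (heq : (u⁻¹ * w).toWord.head? = (u⁻¹ * w').toWord.head?) : u⁻¹ * w = 1 := by
    rw [← FreeGroup.toWord_eq_nil_iff]
    by_contra hne
    rw [hs, hs'] at heq
    rw [hs] at hne
    have hlt : k < w.toWord.length := by
      by_contra hle
      exact hne (List.drop_eq_nil_of_le (not_lt.1 hle))
    rw [List.head?_drop, List.head?_drop] at heq
    have hlt' : k < w'.toWord.length := by
      rw [List.getElem?_eq_getElem hlt] at heq
      exact (List.getElem?_eq_some_iff.1 heq.symm).1
    have := hmax (k + 1) hlt hlt' (by rw [List.take_add_one, List.take_add_one, htake, heq])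
    omega
  obtain ⟨a, ha, haK⟩ := A.exists_mem_seg_of_head? (hhead w rfl) hQ' (hmem w hR)
  obtain ⟨b, hb, hbK⟩ := A.exists_mem_seg_of_head? (hhead w' htake) hQ' (hmem w' hR')
  obtain ⟨c, hc, hcK⟩ := A.exists_mem_seg_of_head? hhead' (hmem w hR) (hmem w' hR')
  obtain ⟨P, h₁, h₂, h₃⟩ := exists_median Q R R'
  refine ⟨P, ?_, seg_inter_seg_eq h₁ h₂ h₃⟩
  rw [Set.mem_smul_set_iff_inv_smul_mem]
  exact A.emb_subtree.mem_of_mem_seg (smul_mem_seg u⁻¹ h₁) (smul_mem_seg u⁻¹ h₂)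
    (smul_mem_seg u⁻¹ h₃) ha haK hb hbK hc hcK

end CHL
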